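/- There exists a constant C > 0 such that for all x ∈ ℝ, |e_μ(x)| ≤ e_μ(|x|) ≤ C (1+|x|)^{-μ} e^{|x|}. -/

import Mathlib

open MeasureTheory Real Set

/-- The generalized factorial γ_μ: γ_μ(2m) = 2^{2m} m! Γ(m+μ+1/2)/Γ(μ+1/2),
γ_μ(2m+1) = 2^{2m+1} m! Γ(m+μ+3/2)/Γ(μ+1/2). -/
noncomputable def genGamma (μ : ℝ) (n : ℕ) : ℝ :=
  if Even n then
    2 ^ n * (Nat.factorial (n / 2)) * Real.Gamma (((n / 2 : ℕ) : ℝ) + μ + 1 / 2) /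
      Real.Gamma (μ + 1 / 2)
  else
    2 ^ n * (Nat.factorial (n / 2)) * Real.Gamma (((n / 2 : ℕ) : ℝ) + μ + 3 / 2) /
      Real.Gamma (μ + 1 / 2)

/-- The generalized exponential function e_μ(x) = Σ_{m} x^m / γ_μ(m). -/
noncomputable def genExp (μ : ℝ) (x : ℝ) : ℝ := ∑' m : ℕ, x ^ m / genGamma μ m

lemma rpow_add_one_mul_sub_le {μ y : ℝ} (hμ : 0 ≤ μ) (hy : 0 < y) :
    (y + 1) ^ μ * (y - μ) ≤ y * y ^ μ := by
  have h1 : (y + 1) ^ μ = y ^ μ * (1 / y + 1) ^ μ := by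
    rw [← mul_rpow hy.le (by positivity)]
    congr 1
    field_simp
    ring
  have h2 : (1 / y + 1) ^ μ ≤ exp (μ / y) := by
    calc (1 / y + 1) ^ μ ≤ (exp (1 / y)) ^ μ :=
          rpow_le_rpow (by positivity) (add_one_le_exp _) hμ
      _ = exp (μ / y) := by rw [← exp_mul]; congr 1; ring
  have h3 : 1 - μ / y ≤ exp (-(μ / y)) := by
    linarith [add_one_le_exp (-(μ / y))]
  have h4 : (1 / y + 1) ^ μ * (1 - μ / y) ≤ 1 := by
    calc (1 / y + 1) ^ μ * (1 - μ / y) ≤ (1 / y + 1) ^ μ * exp (-(μ / y)) := by gcongr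
      _ ≤ exp (μ / y) * exp (-(μ / y)) := by gcongr
      _ = 1 := by rw [← exp_add]; simp
  calc (y + 1) ^ μ * (y - μ) = (y * y ^ μ) * ((1 / y + 1) ^ μ * (1 - μ / y)) := by
        rw [h1]; field_simp
    _ ≤ (y * y ^ μ) * 1 := by gcongr
    _ = y * y ^ μ := mul_one _

lemma exists_mul_Gamma_add_half_le_of_nonneg {μ : ℝ} (hμ : 0 ≤ μ) :
    ∃ c : ℝ, 0 < c ∧ ∀ m : ℕ,
      c * ((m : ℝ) + 1) ^ μ * Gamma (m + 1 / 2) ≤ Gamma (m + μ + 1 / 2) := by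
  have ha : 0 < μ + 1 / 2 := by positivity
  obtain ⟨c, hc, hbase⟩ : ∃ c : ℝ, 0 < c ∧
      c * (μ + 1 / 2) ^ μ * Gamma (1 / 2) = Gamma (μ + 1 / 2) := by
    have hG := Gamma_pos_of_pos ha
    have hG' := Gamma_pos_of_pos (show (0 : ℝ) < 1 / 2 by norm_num)
    have hp : 0 < (μ + 1 / 2) ^ μ := by positivity
    refine ⟨Gamma (μ + 1 / 2) / ((μ + 1 / 2) ^ μ * Gamma (1 / 2)), by positivity, ?_⟩
    field_simp
  have key : ∀ m : ℕ,
      c * ((m : ℝ) + μ + 1 / 2) ^ μ * Gamma (m + 1 / 2) ≤ Gamma (m + μ + 1 / 2) := by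
    intro m
    induction m with
    | zero => simpa using hbase.le
    | succ m ih =>
      have hm : (0 : ℝ) < m + 1 / 2 := by positivity
      have hy : (0 : ℝ) < m + μ + 1 / 2 := by positivity
      have hG := Gamma_pos_of_pos hm
      have e1 : ((m + 1 : ℕ) : ℝ) + 1 / 2 = (m + 1 / 2) + 1 := by push_cast; ring
      have e2 : ((m + 1 : ℕ) : ℝ) + μ + 1 / 2 = (m + μ + 1 / 2) + 1 := by push_cast; ring
      rw [e1, e2, Gamma_add_one hm.ne', Gamma_add_one hy.ne']
      have hstep := rpow_add_one_mul_sub_le hμ hy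
      have e3 : (m : ℝ) + μ + 1 / 2 - μ = m + 1 / 2 := by ring
      rw [e3] at hstep
      calc c * ((m : ℝ) + μ + 1 / 2 + 1) ^ μ * ((m + 1 / 2) * Gamma (m + 1 / 2))
          = c * Gamma (m + 1 / 2) * (((m : ℝ) + μ + 1 / 2 + 1) ^ μ * (m + 1 / 2)) := by ring
        _ ≤ c * Gamma (m + 1 / 2) * ((m + μ + 1 / 2) * (m + μ + 1 / 2) ^ μ) := by gcongr
        _ = (m + μ + 1 / 2) * (c * ((m : ℝ) + μ + 1 / 2) ^ μ * Gamma (m + 1 / 2)) := by ring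
        _ ≤ (m + μ + 1 / 2) * Gamma (m + μ + 1 / 2) := by gcongr
  refine ⟨c * (1 / 2) ^ μ, by positivity, fun m => le_trans ?_ (key m)⟩
  have hG := Gamma_pos_of_pos (show (0 : ℝ) < m + 1 / 2 by positivity)
  rw [mul_assoc c, ← mul_rpow (by norm_num) (by positivity)]
  gcongr
  linarith [(Nat.cast_nonneg m : (0 : ℝ) ≤ m)]

lemma exists_mul_Gamma_add_half_le {μ : ℝ} (hμ : -1 / 2 < μ) :
    ∃ c : ℝ, 0 < c ∧ ∀ m : ℕ,
      c * ((m : ℝ) + 1) ^ μ * Gamma (m + 1 / 2) ≤ Gamma (m + μ + 1 / 2) := by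
  rcases le_or_gt 0 μ with h | h
  · exact exists_mul_Gamma_add_half_le_of_nonneg h
  obtain ⟨c, hc, H⟩ := exists_mul_Gamma_add_half_le_of_nonneg (show 0 ≤ μ + 1 by linarith)
  refine ⟨c, hc, fun m => ?_⟩
  have hm : (0 : ℝ) ≤ m := Nat.cast_nonneg m
  have hy : (0 : ℝ) < m + μ + 1 / 2 := by linarith
  have hG := Gamma_pos_of_pos hy
  have := H m
  rw [show (m : ℝ) + (μ + 1) + 1 / 2 = (m + μ + 1 / 2) + 1 by ring, Gamma_add_one hy.ne',
    rpow_add_one (by positivity)] at this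
  have h2 : (m + μ + 1 / 2) * Gamma (m + μ + 1 / 2) ≤ (m + 1) * Gamma (m + μ + 1 / 2) := by
    gcongr ?_ * _
    linarith
  refine le_of_mul_le_mul_left ?_ (show (0 : ℝ) < m + 1 by positivity)
  linarith

lemma two_pow_mul_factorial_mul_Gamma_add_half (m : ℕ) :
    2 ^ (2 * m) * (m.factorial : ℝ) * Gamma (m + 1 / 2) = (2 * m).factorial * √π := by
  have h := Gamma_mul_Gamma_add_half ((m : ℝ) + 1 / 2)
  rw [show (m : ℝ) + 1 / 2 + 1 / 2 = m + 1 by ring, Gamma_nat_eq_factorial,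
    show 2 * ((m : ℝ) + 1 / 2) = ((2 * m : ℕ) : ℝ) + 1 by push_cast; ring,
    Gamma_nat_eq_factorial,
    show (1 : ℝ) - (((2 * m : ℕ) : ℝ) + 1) = -((2 * m : ℕ) : ℝ) by ring,
    rpow_neg (by norm_num), rpow_natCast] at h
  rw [mul_assoc, mul_comm (m.factorial : ℝ), h]
  field_simp

lemma two_pow_mul_factorial_mul_Gamma_add_three_half (m : ℕ) :
    2 ^ (2 * m + 1) * (m.factorial : ℝ) * Gamma (m + 1 + 1 / 2) =
      (2 * m + 1).factorial * √π := by
  have h := two_pow_mul_factorial_mul_Gamma_add_half m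
  rw [show (m : ℝ) + 1 + 1 / 2 = (m + 1 / 2) + 1 by ring, Gamma_add_one (by positivity),
    Nat.factorial_succ]
  push_cast
  linear_combination (2 * (m : ℝ) + 1) * h

lemma genGamma_pos {μ : ℝ} (hμ : -1 / 2 < μ) (n : ℕ) : 0 < genGamma μ n := by
  have hn : (0 : ℝ) ≤ ((n / 2 : ℕ) : ℝ) := Nat.cast_nonneg _
  have h0 := Gamma_pos_of_pos (show 0 < μ + 1 / 2 by linarith)
  have h1 := Gamma_pos_of_pos (show 0 < ((n / 2 : ℕ) : ℝ) + μ + 1 / 2 by linarith)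
  have h2 := Gamma_pos_of_pos (show 0 < ((n / 2 : ℕ) : ℝ) + μ + 3 / 2 by linarith)
  unfold genGamma
  split_ifs <;> positivity

lemma exists_mul_factorial_le_genGamma {μ : ℝ} (hμ : -1 / 2 < μ) :
    ∃ c : ℝ, 0 < c ∧ ∀ n : ℕ,
      c * n.factorial * ((((n + 1) / 2 : ℕ) : ℝ) + 1) ^ μ ≤ genGamma μ n := by
  obtain ⟨c, hc, H⟩ := exists_mul_Gamma_add_half_le hμ
  have h0 := Gamma_pos_of_pos (show 0 < μ + 1 / 2 by linarith)
  refine ⟨c * √π / Gamma (μ + 1 / 2), by positivity, fun n => ?_⟩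
  rcases Nat.even_or_odd' n with ⟨m, rfl | rfl⟩
  · have hw : (2 * m + 1) / 2 = m := by omega
    have hd : 2 * m / 2 = m := by omega
    rw [genGamma, if_pos (even_two_mul m), hw, hd, le_div_iff₀ h0]
    calc c * √π / Gamma (μ + 1 / 2) * (2 * m).factorial * ((m : ℝ) + 1) ^ μ * Gamma (μ + 1 / 2)
        = c * ((m : ℝ) + 1) ^ μ * ((2 * m).factorial * √π) := by
          generalize Gamma (μ + 1 / 2) = G at h0
          field_simp
      _ = 2 ^ (2 * m) * (m.factorial : ℝ) * (c * ((m : ℝ) + 1) ^ μ * Gamma (m + 1 / 2)) := by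
        rw [← two_pow_mul_factorial_mul_Gamma_add_half]; ring
      _ ≤ _ := by gcongr; exact H m
  · have hw : (2 * m + 1 + 1) / 2 = m + 1 := by omega
    have hd : (2 * m + 1) / 2 = m := by omega
    have Hm := H (m + 1)
    rw [show ((m + 1 : ℕ) : ℝ) + μ + 1 / 2 = m + μ + 3 / 2 by push_cast; ring] at Hm
    rw [genGamma, if_neg (by simp), hw, hd, le_div_iff₀ h0]
    calc c * √π / Gamma (μ + 1 / 2) * (2 * m + 1).factorial * (((m + 1 : ℕ) : ℝ) + 1) ^ μ *
          Gamma (μ + 1 / 2)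
        = c * (((m + 1 : ℕ) : ℝ) + 1) ^ μ * ((2 * m + 1).factorial * √π) := by
          generalize Gamma (μ + 1 / 2) = G at h0
          field_simp
      _ = 2 ^ (2 * m + 1) * (m.factorial : ℝ) *
          (c * (((m + 1 : ℕ) : ℝ) + 1) ^ μ * Gamma (((m + 1 : ℕ) : ℝ) + 1 / 2)) := by
        rw [← two_pow_mul_factorial_mul_Gamma_add_three_half]; push_cast; ring
      _ ≤ _ := by gcongr

lemma factorial_add_le_mul_pow (n k : ℕ) :
    (n + k).factorial ≤ k.factorial * n.factorial * (n + 1) ^ k := by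
  induction k with
  | zero => simp
  | succ k ih =>
    rw [← add_assoc, Nat.factorial_succ, Nat.factorial_succ k, pow_succ]
    calc (n + k + 1) * (n + k).factorial
        ≤ ((k + 1) * (n + 1)) * (k.factorial * n.factorial * (n + 1) ^ k) := by
          gcongr
          nlinarith [Nat.zero_le (k * n)]
      _ = _ := by ring

lemma pow_div_factorial_mul_div_pow_le {x : ℝ} (hx : 0 ≤ x) (n k : ℕ) :
    x ^ n / n.factorial * ((1 + x) / (n + 1)) ^ k ≤
      2 ^ k * (x ^ n / n.factorial + k.factorial * (x ^ (n + k) / (n + k).factorial)) := by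
  have h1 : (1 + x) ^ k ≤ 2 ^ k * (1 + x ^ k) := by
    calc (1 + x) ^ k ≤ 2 ^ (k - 1) * (1 ^ k + x ^ k) := add_pow_le zero_le_one hx k
      _ ≤ 2 ^ k * (1 + x ^ k) := by
        rw [one_pow]
        gcongr
        · norm_num
        · omega
  have h2 : x ^ n / n.factorial / ((n : ℝ) + 1) ^ k ≤ x ^ n / n.factorial :=
    div_le_self (by positivity) (one_le_pow₀ (by linarith [(Nat.cast_nonneg n : (0 : ℝ) ≤ n)]))
  have h3 : x ^ (n + k) / (n.factorial * ((n : ℝ) + 1) ^ k) ≤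
      k.factorial * (x ^ (n + k) / (n + k).factorial) := by
    have hf : ((n + k).factorial : ℝ) ≤ k.factorial * n.factorial * ((n : ℝ) + 1) ^ k := by
      exact_mod_cast factorial_add_le_mul_pow n k
    rw [← mul_div_assoc, div_le_div_iff₀ (by positivity) (by positivity)]
    calc x ^ (n + k) * (n + k).factorial
        ≤ x ^ (n + k) * (k.factorial * n.factorial * ((n : ℝ) + 1) ^ k) := by gcongr
      _ = _ := by ring
  calc x ^ n / n.factorial * ((1 + x) / (n + 1)) ^ k
      = x ^ n / n.factorial / ((n : ℝ) + 1) ^ k * (1 + x) ^ k := by rw [div_pow]; ring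
    _ ≤ x ^ n / n.factorial / ((n : ℝ) + 1) ^ k * (2 ^ k * (1 + x ^ k)) := by gcongr
    _ = 2 ^ k * (x ^ n / n.factorial / ((n : ℝ) + 1) ^ k +
          x ^ (n + k) / (n.factorial * ((n : ℝ) + 1) ^ k)) := by
        rw [pow_add]; field_simp
    _ ≤ _ := by gcongr

lemma hasSum_pow_div_factorial (x : ℝ) :
    HasSum (fun n : ℕ => x ^ n / n.factorial) (exp x) := by
  rw [exp_eq_exp_ℝ]
  exact NormedSpace.expSeries_div_hasSum_exp x

lemma hasSum_pow_div_factorial_mul_add_one (x : ℝ) :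
    HasSum (fun n : ℕ => x ^ n / n.factorial * (n + 1)) ((1 + x) * exp x) := by
  have h : HasSum (fun n : ℕ => x ^ n / n.factorial * n) (x * exp x) := by
    rw [← hasSum_nat_add_iff' 1]
    have := (hasSum_pow_div_factorial x).mul_left x
    simp only [Finset.sum_range_one, Nat.cast_zero, mul_zero, sub_zero]
    refine this.congr_fun ?_
    intro n
    rw [Nat.factorial_succ]
    push_cast
    field_simp
    ring
  convert h.add (hasSum_pow_div_factorial x) using 1
  · ext n; ring
  · ring

lemma sum_shift_pow_div_factorial_le {x : ℝ} (hx : 0 ≤ x) (k : ℕ) :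
    Summable (fun n : ℕ => x ^ (n + k) / (n + k).factorial) ∧
      ∑' n : ℕ, x ^ (n + k) / (n + k).factorial ≤ exp x := by
  have h := hasSum_pow_div_factorial x
  have hs := (summable_nat_add_iff k).2 h.summable
  refine ⟨hs, ?_⟩
  rw [← h.tsum_eq, ← h.summable.sum_add_tsum_nat_add k]
  exact le_add_of_nonneg_left (Finset.sum_nonneg fun i _ => by positivity)

lemma rpow_le_pow_add_inv {r μ : ℝ} {k : ℕ} (hr : 0 < r) (h1 : -1 ≤ μ) (h2 : μ ≤ k) :
    r ^ μ ≤ r ^ k + r⁻¹ := by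
  rcases le_total 1 r with h | h
  · have := rpow_le_rpow_of_exponent_le h h2
    rw [rpow_natCast] at this
    linarith [inv_pos.2 hr]
  · have := rpow_le_rpow_of_exponent_ge hr h h1
    rw [rpow_neg_one] at this
    linarith [pow_pos hr k]

lemma exists_summable_and_genExp_le {μ : ℝ} (hμ : -1 / 2 < μ) :
    ∃ C : ℝ, 0 < C ∧ ∀ x : ℝ, 0 ≤ x → Summable (fun n : ℕ => x ^ n / genGamma μ n) ∧
      genExp μ x ≤ C * (1 + x) ^ (-μ) * exp x := by
  obtain ⟨c, hc, H⟩ := exists_mul_factorial_le_genGamma hμ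
  obtain ⟨k, hk⟩ := exists_nat_ge μ
  refine ⟨c⁻¹ * (2 ^ k * (2 ^ k * (1 + k.factorial)) + 1), by positivity, fun x hx => ?_⟩
  have hx1 : 0 < 1 + x := by linarith
  set S : ℕ → ℝ := fun n => c⁻¹ * (1 + x) ^ (-μ) *
    (2 ^ k * (2 ^ k * (x ^ n / n.factorial +
      k.factorial * (x ^ (n + k) / (n + k).factorial))) +
      x ^ n / n.factorial * (n + 1) * (1 + x)⁻¹) with hS
  have hle : ∀ n : ℕ, x ^ n / genGamma μ n ≤ S n := by
    intro n
    set w : ℝ := (((n + 1) / 2 : ℕ) : ℝ) + 1 with hw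
    have hw0 : 0 < w := by positivity
    have hw1 : w ≤ n + 1 := by
      rw [hw]
      gcongr
      omega
    have hw2 : ((n : ℝ) + 1) ≤ 2 * w := by
      rw [hw]
      exact_mod_cast (by omega : n + 1 ≤ 2 * ((n + 1) / 2 + 1))
    have hr : ((1 + x) / w) ^ μ ≤
        2 ^ k * ((1 + x) / (n + 1)) ^ k + (n + 1) * (1 + x)⁻¹ := by
      refine (rpow_le_pow_add_inv (by positivity) (by linarith) hk).trans ?_
      rw [← mul_pow, inv_div, ← div_eq_mul_inv]
      gcongr
      rw [← mul_div_assoc, div_le_div_iff₀ hw0 (by positivity)]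
      nlinarith
    calc x ^ n / genGamma μ n ≤ x ^ n / (c * n.factorial * w ^ μ) := by
          gcongr
          exact H n
      _ = c⁻¹ * (1 + x) ^ (-μ) * (x ^ n / n.factorial * ((1 + x) / w) ^ μ) := by
          rw [div_rpow hx1.le hw0.le, rpow_neg hx1.le]
          have := rpow_pos_of_pos hx1 μ
          have := rpow_pos_of_pos hw0 μ
          field_simp
      _ ≤ c⁻¹ * (1 + x) ^ (-μ) * (x ^ n / n.factorial *
          (2 ^ k * ((1 + x) / (n + 1)) ^ k + (n + 1) * (1 + x)⁻¹)) := by gcongr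
      _ = c⁻¹ * (1 + x) ^ (-μ) * (2 ^ k * (x ^ n / n.factorial * ((1 + x) / (n + 1)) ^ k) +
          x ^ n / n.factorial * (n + 1) * (1 + x)⁻¹) := by ring
      _ ≤ S n := by
          simp only [hS]
          gcongr _ * (_ * ?_ + _)
          exact pow_div_factorial_mul_div_pow_le hx n k
  obtain ⟨hs, hsle⟩ := sum_shift_pow_div_factorial_le hx k
  have hsum : HasSum S _ :=
    (((((hasSum_pow_div_factorial x).add (hs.hasSum.mul_left (k.factorial : ℝ))).mul_left
      (2 ^ k)).mul_left (2 ^ k)).add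
      ((hasSum_pow_div_factorial_mul_add_one x).mul_right (1 + x)⁻¹)).mul_left
      (c⁻¹ * (1 + x) ^ (-μ))
  have hsm : Summable (fun n : ℕ => x ^ n / genGamma μ n) :=
    hsum.summable.of_nonneg_of_le
      (fun n => div_nonneg (pow_nonneg hx n) (genGamma_pos hμ n).le) hle
  refine ⟨hsm, (hsm.tsum_le_tsum hle hsum.summable).trans ?_⟩
  rw [hsum.tsum_eq, mul_comm (1 + x), mul_assoc (exp x), mul_inv_cancel₀ hx1.ne', mul_one]
  calc _ ≤ c⁻¹ * (1 + x) ^ (-μ) *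
        (2 ^ k * (2 ^ k * (exp x + k.factorial * exp x)) + exp x) := by gcongr
    _ = _ := by ring

/-- Bounds for the generalized exponential:
|e_μ(x)| ≤ e_μ(|x|) ≤ C (1+|x|)^{-μ} e^{|x|}. -/
theorem genExp_bounds (μ : ℝ) (hμ : -1 / 2 < μ) :
    ∃ C : ℝ, 0 < C ∧ ∀ x : ℝ,
      |genExp μ x| ≤ genExp μ |x| ∧
        genExp μ |x| ≤ C * (1 + |x|) ^ (-μ) * Real.exp |x| := by
  obtain ⟨C, hC, H⟩ := exists_summable_and_genExp_le hμ
  refine ⟨C, hC, fun x => ?_⟩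
  obtain ⟨hs, hle⟩ := H |x| (abs_nonneg x)
  refine ⟨?_, hle⟩
  have hnorm : ∀ n : ℕ, ‖x ^ n / genGamma μ n‖ = |x| ^ n / genGamma μ n := fun n => by
    rw [norm_div, norm_pow, norm_eq_abs, norm_of_nonneg (genGamma_pos hμ n).le]
  have h := norm_tsum_le_tsum_norm (f := fun n : ℕ => x ^ n / genGamma μ n)
    (by simpa only [hnorm] using hs)
  simpa only [hnorm, norm_eq_abs, genExp] using h
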